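/- Let T : U → V be a C¹ bijection between open subsets of ℚ_p^n with C¹ inverse, and let φ : V → ℝ be integrable. Then ∫_V φ(y) dy = ∫_U φ(T(x)) |det DT(x)| dx, where DT is the Jacobian matrix of T and |·| the p-adic absolute value. -/

import Mathlib

open MeasureTheory Metric Set
open scoped ENNReal NNReal Topology

section
variable {p : ℕ} [Fact p.Prime] [MeasurableSpace ℚ_[p]] [BorelSpace ℚ_[p]]

lemma padic_ball_decomp (k : ℤ) : closedBall (0 : ℚ_[p]) ((p:ℝ)^(k+1)) =
    ⋃ i ∈ Finset.range p, closedBall ((i:ℚ_[p]) * (p:ℚ_[p])^(-(k+1))) ((p:ℝ)^k) := by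
  have hp : (0:ℝ) < p := by exact_mod_cast (Fact.out : p.Prime).pos
  have hp1 : (1:ℝ) ≤ p := by exact_mod_cast (Fact.out : p.Prime).one_le
  have hpQ : (p:ℚ_[p]) ≠ 0 := by exact_mod_cast (Fact.out : p.Prime).ne_zero
  ext x
  simp only [mem_closedBall, dist_eq_norm, sub_zero, mem_iUnion, Finset.mem_range, exists_prop]
  constructor
  · intro hx
    have h1 : ‖x * (p:ℚ_[p])^(k+1)‖ ≤ 1 := by
      rw [norm_mul, Padic.norm_p_zpow, zpow_neg]
      exact mul_inv_le_one_of_le₀ hx (by positivity)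
    obtain ⟨i, hi, h⟩ := PadicInt.exists_mem_range (⟨x * (p:ℚ_[p])^(k+1), h1⟩ : ℤ_[p])
    refine ⟨i, hi, ?_⟩
    rw [PadicInt.maximalIdeal_eq_span_p, ← pow_one (p:ℤ_[p]),
      ← PadicInt.norm_le_pow_iff_mem_span_pow, PadicInt.norm_def] at h
    change ‖x * (p:ℚ_[p])^(k+1) - ((i : ℤ_[p]) : ℚ_[p])‖ ≤ _ at h
    rw [PadicInt.coe_natCast] at h
    have : x - i * (p:ℚ_[p])^(-(k+1)) = (x * (p:ℚ_[p])^(k+1) - i) * (p:ℚ_[p])^(-(k+1)) := by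
      rw [sub_mul, mul_assoc, ← zpow_add₀ hpQ]; simp
    rw [this, norm_mul, Padic.norm_p_zpow, neg_neg, zpow_add_one₀ hp.ne']
    calc _ ≤ (p:ℝ)^(-1:ℤ) * ((p:ℝ)^k * p) := by gcongr; exact h
      _ = _ := by rw [zpow_neg_one]; field_simp
  · rintro ⟨i, hi, h⟩
    rw [← sub_add_cancel x (i * (p:ℚ_[p])^(-(k+1)))]
    refine (IsUltrametricDist.norm_add_le_max _ _).trans (max_le (h.trans ?_) ?_)
    · exact zpow_le_zpow_right₀ hp1 (by lia)
    · rw [norm_mul, Padic.norm_p_zpow, neg_neg]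
      have := Padic.norm_int_le_one (p := p) (i:ℤ)
      push_cast at this
      exact mul_le_of_le_one_left (by positivity) this

lemma padic_ball_disj (k : ℤ) : (Finset.range p : Set ℕ).PairwiseDisjoint
    (fun i : ℕ => closedBall ((i:ℚ_[p]) * (p:ℚ_[p])^(-(k+1))) ((p:ℝ)^k)) := by
  have hp : (0:ℝ) < p := by exact_mod_cast (Fact.out : p.Prime).pos
  have hp1 : (1:ℝ) < p := by exact_mod_cast (Fact.out : p.Prime).one_lt
  intro i hi j hj hij
  rw [Function.onFun, Set.disjoint_left]
  intro x hx hy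
  have h : dist ((i:ℚ_[p]) * (p:ℚ_[p])^(-(k+1))) ((j:ℚ_[p]) * (p:ℚ_[p])^(-(k+1))) ≤ (p:ℝ)^k :=
    (dist_triangle_max _ x _).trans (max_le (by rw [dist_comm]; exact hx) hy)
  rw [dist_eq_norm, ← sub_mul, norm_mul, Padic.norm_p_zpow, neg_neg, zpow_add_one₀ hp.ne'] at h
  have h2 : ‖(i:ℚ_[p]) - j‖ < 1 := by
    by_contra! h3
    have : (p:ℝ)^k * 1 < (p:ℝ)^k * p := by gcongr
    have : 1 * ((p:ℝ)^k * p) ≤ ‖(i:ℚ_[p]) - j‖ * ((p:ℝ)^k * p) := by gcongr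
    linarith
  have h4 : ‖(((i:ℤ) - (j:ℤ) : ℤ) : ℚ_[p])‖ < 1 := by push_cast; exact h2
  rw [Padic.norm_intCast_lt_one_iff] at h4
  simp only [Finset.coe_range, mem_Iio] at hi hj
  apply hij
  have := Int.eq_zero_of_abs_lt_dvd h4 (by rw [abs_lt]; constructor <;> lia)
  lia

lemma padic_measure_ball (μ : Measure ℚ_[p]) [μ.IsAddHaarMeasure]
    (hμ : μ {x : ℚ_[p] | ‖x‖ ≤ 1} = 1) (k : ℤ) :
    μ (closedBall (0 : ℚ_[p]) ((p:ℝ)^k)) = ENNReal.ofReal ((p:ℝ)^k) := by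
  have hp : (0:ℝ) < p := by exact_mod_cast (Fact.out : p.Prime).pos
  have key : ∀ k : ℤ, μ (closedBall (0 : ℚ_[p]) ((p:ℝ)^(k+1))) =
      p * μ (closedBall (0 : ℚ_[p]) ((p:ℝ)^k)) := by
    intro k
    rw [padic_ball_decomp k, measure_biUnion_finset (padic_ball_disj k)
      (fun _ _ => isClosed_closedBall.measurableSet)]
    have : ∀ c : ℚ_[p], μ (closedBall c ((p:ℝ)^k)) = μ (closedBall 0 ((p:ℝ)^k)) := by
      intro c
      rw [← measure_preimage_add μ c]; simp
    simp [this]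
  have hmul : ∀ k : ℤ, ENNReal.ofReal ((p:ℝ)^(k+1)) = p * ENNReal.ofReal ((p:ℝ)^k) := by
    intro k
    rw [zpow_add_one₀ hp.ne', mul_comm, ENNReal.ofReal_mul hp.le, ENNReal.ofReal_natCast]
  have hp0 : (p:ℝ≥0∞) ≠ 0 := by exact_mod_cast (Fact.out : p.Prime).ne_zero
  induction k using Int.induction_on with
  | zero => simpa [closedBall, dist_eq_norm] using hμ
  | succ i ih => rw [key, ih, hmul]
  | pred i ih =>
    have h1 := key (-(i:ℤ) - 1)
    have h2 := hmul (-(i:ℤ) - 1)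
    rw [sub_add_cancel] at h1 h2
    rw [h1, h2] at ih
    exact (ENNReal.mul_right_inj hp0 (ENNReal.natCast_ne_top p)).1 ih

lemma padic_map_mul (μ : Measure ℚ_[p]) [μ.IsAddHaarMeasure]
    (hμ : μ {x : ℚ_[p] | ‖x‖ ≤ 1} = 1) (a : ℚ_[p]) (ha : a ≠ 0) :
    Measure.map (fun x => a * x) μ = ENNReal.ofReal ‖a‖⁻¹ • μ := by
  have h0 : Measure.IsAddHaarMeasure (Measure.map (fun x => a * x) μ) :=
    (ContinuousLinearEquiv.smulLeft (R₁ := ℚ_[p]) (M₁ := ℚ_[p]) (Units.mk0 a ha)).isAddHaarMeasure_map μ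
  have h := Measure.isAddLeftInvariant_eq_smul (Measure.map (fun x => a * x) μ) μ
  have h1 : Measure.map (fun x => a * x) μ (closedBall 0 1) = ENNReal.ofReal ‖a‖⁻¹ := by
    rw [Measure.map_apply (by fun_prop) isClosed_closedBall.measurableSet]
    have e : ‖a‖⁻¹ = (p:ℝ)^a.valuation := by
      rw [Padic.norm_eq_zpow_neg_valuation ha, zpow_neg, inv_inv]
    rw [e, ← padic_measure_ball μ hμ, ← e]
    congr 1
    ext x
    have : 0 < ‖a‖ := norm_pos_iff.2 ha
    simp only [mem_preimage, mem_closedBall, dist_zero_right, norm_mul]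
    rw [inv_eq_one_div, le_div_iff₀ this, mul_comm]
  rw [h] at h1 ⊢
  have h2 : μ (closedBall 0 1) = 1 := by simpa [closedBall, dist_eq_norm] using hμ
  rw [Measure.smul_apply, h2, ENNReal.smul_def, smul_eq_mul, mul_one] at h1
  rw [ENNReal.smul_def, h1]

open Matrix in
lemma padic_transvection (μ : Measure ℚ_[p]) [μ.IsAddHaarMeasure] (n : ℕ)
    (t : TransvectionStruct (Fin n) ℚ_[p]) :
    MeasurePreserving (toLin' t.toMatrix) (Measure.pi fun _ => μ) (Measure.pi fun _ => μ) := by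
  have ht : Measurable (toLin' t.toMatrix) :=
    (toLin' t.toMatrix).continuous_of_finiteDimensional.measurable
  refine ⟨ht, ?_⟩
  refine (Measure.pi_eq fun s hs ↦ ?_).symm
  have h2s : MeasurableSet (univ.pi s) := .pi countable_univ fun i _ ↦ hs i
  simp_rw [← Measure.pi_pi, ← lintegral_indicator_one h2s]
  rw [lintegral_map (measurable_one.indicator h2s) ht]
  refine lintegral_eq_of_lmarginal_eq {t.i} ((measurable_one.indicator h2s).comp ht)
    (measurable_one.indicator h2s) ?_
  simp_rw [lmarginal_singleton]
  ext x
  cases t with | mk t_i t_j t_hij t_c =>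
  simp [transvection, single_mulVec, t_hij.symm, ← Function.update_add,
    lintegral_add_right_eq_self fun xᵢ ↦ indicator (univ.pi s) 1 (Function.update x t_i xᵢ)]

open Matrix in
lemma padic_map_matrix (μ : Measure ℚ_[p]) [μ.IsAddHaarMeasure]
    (hμ : μ {x : ℚ_[p] | ‖x‖ ≤ 1} = 1) (n : ℕ) (M : Matrix (Fin n) (Fin n) ℚ_[p]) (hM : M.det ≠ 0) :
    Measure.map (toLin' M) (Measure.pi fun _ => μ) =
      ENNReal.ofReal ‖M.det‖⁻¹ • (Measure.pi fun _ => μ) := by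
  apply diagonal_transvection_induction_of_det_ne_zero _ M hM
  · intro D hD
    rw [det_diagonal] at hD ⊢
    have hD' : ∀ i, D i ≠ 0 := fun i => Finset.prod_ne_zero_iff.1 hD i (Finset.mem_univ i)
    have e : (toLin' (diagonal D) : (Fin n → ℚ_[p]) → (Fin n → ℚ_[p])) = fun x i => D i * x i := by
      ext x i; simp [mulVec_diagonal]
    have := fun i => padic_map_mul μ hμ (D i) (hD' i)
    have sf : ∀ i, SigmaFinite (Measure.map (fun x => D i * x) μ) := by
      intro i
      exact ((Homeomorph.mulLeft₀ (D i) (hD' i)).toMeasurableEquiv).sigmaFinite_map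
    rw [e, Measure.pi_map_pi (f := fun i (x : ℚ_[p]) => D i * x) (fun i => by fun_prop)]
    refine Measure.pi_eq fun s hs => ?_
    simp [this, Finset.prod_mul_distrib, ← Finset.prod_inv_distrib, ENNReal.ofReal_prod_of_nonneg]
  · intro t
    simp [(padic_transvection μ n t).map_eq]
  · intro A B _ _ IHA IHB
    rw [toLin'_mul, det_mul, LinearMap.coe_comp, ← Measure.map_map, IHB, Measure.map_smul, IHA,
      smul_smul, ← ENNReal.ofReal_mul (by positivity), norm_mul, mul_comm, mul_inv]
    · exact (LinearMap.continuous_on_pi _).measurable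
    · exact (LinearMap.continuous_on_pi _).measurable

lemma padic_image_linear (μ : Measure ℚ_[p]) [μ.IsAddHaarMeasure]
    (hμ : μ {x : ℚ_[p] | ‖x‖ ≤ 1} = 1) (n : ℕ)
    (L : (Fin n → ℚ_[p]) ≃L[ℚ_[p]] (Fin n → ℚ_[p])) (s : Set (Fin n → ℚ_[p])) :
    (Measure.pi fun _ => μ) (L '' s) =
      ENNReal.ofReal ‖(L : (Fin n → ℚ_[p]) →L[ℚ_[p]] (Fin n → ℚ_[p])).det‖ *
        (Measure.pi fun _ => μ) s := by
  have hd : (L : (Fin n → ℚ_[p]) →L[ℚ_[p]] (Fin n → ℚ_[p])).det *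
     (L.symm : (Fin n → ℚ_[p]) →L[ℚ_[p]] (Fin n → ℚ_[p])).det = 1 := by
    rw [ContinuousLinearMap.det, ContinuousLinearMap.det, ← LinearMap.det_comp]
    convert LinearMap.det_id
    ext x; simp
  have hs : LinearMap.det (L.symm : (Fin n → ℚ_[p]) →ₗ[ℚ_[p]] (Fin n → ℚ_[p])) ≠ 0 :=
    right_ne_zero_of_mul_eq_one hd
  have := padic_map_matrix μ hμ n
    (LinearMap.toMatrix' (L.symm : (Fin n → ℚ_[p]) →ₗ[ℚ_[p]] (Fin n → ℚ_[p])))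
    (by rwa [LinearMap.det_toMatrix'])
  rw [Matrix.toLin'_toMatrix', LinearMap.det_toMatrix'] at this
  have h2 := congrArg (fun m => m s) this
  simp only [Measure.smul_apply, smul_eq_mul] at h2
  rw [ContinuousLinearEquiv.image_eq_preimage_symm, eq_inv_of_mul_eq_one_left hd, norm_inv]
  refine Eq.trans ?_ h2
  exact ((L.symm.toHomeomorph.toMeasurableEquiv).map_apply s).symm

lemma ultra_image_ball {E : Type*} [NormedAddCommGroup E] [IsUltrametricDist E] [CompleteSpace E]
    (h : E → E) (x : E) (r : ℝ) (K : ℝ≥0) (hK : K < 1)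
    (hh : ∀ y ∈ ball x r, ∀ z ∈ ball x r, ‖h y - h z - (y - z)‖ ≤ K * ‖y - z‖)
    (y : E) (hy : y ∈ ball x r) (s : ℝ) (hs : s ≤ r) :
    h '' ball y s = ball (h y) s := by
  have hK1 : (K:ℝ) < 1 := by exact_mod_cast hK
  have hsub : ball y s ⊆ ball x r := by
    rw [IsUltrametricDist.ball_eq_of_mem hy]; exact ball_subset_ball hs
  rcases le_or_gt s 0 with h0 | h0
  · simp [ball_eq_empty.2 h0]
  have hys : y ∈ ball y s := mem_ball_self h0
  apply Subset.antisymm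
  · rintro _ ⟨z, hz, rfl⟩
    have h1 := hh z (hsub hz) y hy
    rw [mem_ball, dist_eq_norm] at hz ⊢
    rw [← sub_add_cancel (h z - h y) (z - y)]
    refine (IsUltrametricDist.norm_add_le_max _ _).trans_lt (max_lt (h1.trans_lt ?_) hz)
    nlinarith [norm_nonneg (z - y)]
  · intro w hw
    let f : E → E := fun z => z - h z + w
    have hf : MapsTo f (ball y s) (ball y s) := by
      intro z hz
      have h1 := hh z (hsub hz) y hy
      rw [mem_ball, dist_eq_norm] at hz hw ⊢
      have : f z - y = (w - h y) - (h z - h y - (z - y)) := by simp only [f]; abel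
      rw [this, sub_eq_add_neg]
      refine (IsUltrametricDist.norm_add_le_max _ _).trans_lt (max_lt hw (by rw [norm_neg]; refine h1.trans_lt ?_; nlinarith [norm_nonneg (z - y)]))
    have hc : ContractingWith K (hf.restrict f (ball y s) (ball y s)) := by
      refine ⟨hK, LipschitzWith.of_dist_le_mul ?_⟩
      rintro ⟨a, ha⟩ ⟨b, hb⟩
      have h1 := hh a (hsub ha) b (hsub hb)
      rw [Subtype.dist_eq, Subtype.dist_eq, dist_eq_norm, dist_eq_norm]
      simp only [MapsTo.val_restrict_apply, f]
      have e : a - h a + w - (b - h b + w) = -(h a - h b - (a - b)) := by abel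
      rw [e, norm_neg]
      exact h1
    obtain ⟨z, hz, hfz, -⟩ := ContractingWith.exists_fixedPoint'
      (IsUltrametricDist.isClosed_ball y s).isComplete hf hc hys (edist_ne_top _ _)
    refine ⟨z, hz, ?_⟩
    have : z - h z + w = z := hfz
    rw [sub_add_eq_add_sub, sub_eq_iff_eq_add] at this
    exact (add_left_cancel this).symm

lemma padic_local (μ : Measure ℚ_[p]) [μ.IsAddHaarMeasure]
    (hμ : μ {x : ℚ_[p] | ‖x‖ ≤ 1} = 1) (n : ℕ) (T : (Fin n → ℚ_[p]) → (Fin n → ℚ_[p]))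
    (L : (Fin n → ℚ_[p]) ≃L[ℚ_[p]] (Fin n → ℚ_[p])) (x : Fin n → ℚ_[p])
    (hT : HasStrictFDerivAt T (L : (Fin n → ℚ_[p]) →L[ℚ_[p]] (Fin n → ℚ_[p])) x)
    (U : Set (Fin n → ℚ_[p])) (hU : U ∈ 𝓝 x) :
    ∃ r > 0, ball x r ⊆ U ∧ ∀ y ∈ ball x r, ∀ s ≤ r,
      (Measure.pi fun _ => μ) (T '' ball y s) =
        ENNReal.ofReal ‖(L : (Fin n → ℚ_[p]) →L[ℚ_[p]] (Fin n → ℚ_[p])).det‖ *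
          (Measure.pi fun _ => μ) (ball y s) := by
  have hh := (L.symm.hasStrictFDerivAt (x := T x)).comp x hT
  obtain ⟨s, hs, ha⟩ := hh.approximates_deriv_on_nhds (c := 1/2) (Or.inr (by norm_num))
  obtain ⟨r, hr, hrs⟩ := Metric.mem_nhds_iff.1 (Filter.inter_mem hs hU)
  refine ⟨r, hr, fun y hy => (hrs hy).2, fun y hy t ht => ?_⟩
  have h1 := ultra_image_ball (L.symm ∘ T) x r (1/2) (by rw [← NNReal.coe_lt_coe]; norm_num)
    (fun y hy z hz => by simpa using ha y (hrs hy).1 z (hrs hz).1) y hy t ht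
  have h2 : T '' ball y t = L '' ball ((L.symm ∘ T) y) t := by
    rw [← h1, ← image_comp]
    congr 1
    ext1 z; simp
  rw [h2, padic_image_linear μ hμ, ← measure_preimage_add _ ((L.symm ∘ T) y - y)]
  congr 2
  ext z
  simp [dist_eq_norm]

lemma ultra_measure_ext {X : Type*} [MetricSpace X] [IsUltrametricDist X]
    [SecondCountableTopology X] [MeasurableSpace X] [BorelSpace X] (m₁ m₂ : Measure X)
    (x : X) (r : ℝ) (hr : 0 < r) (hfin : m₁ (ball x r) ≠ ∞)
    (h : ∀ y ∈ ball x r, ∀ s ≤ r, m₁ (ball y s) = m₂ (ball y s)) :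
    m₁.restrict (ball x r) = m₂.restrict (ball x r) := by
  have hxx := h x (mem_ball_self hr) r le_rfl
  have : IsFiniteMeasure (m₁.restrict (ball x r)) := ⟨by simpa using hfin.lt_top⟩
  let C : Set (Set X) := {b | ∃ y s, b = ball y s}
  have hinter : ∀ y s z t, ball y s ∩ ball z t = ball y s ∨ ball y s ∩ ball z t = ball z t ∨
      ball y s ∩ ball z t = (∅ : Set X) := by
    intro y s z t
    rcases IsUltrametricDist.ball_subset_trichotomy y z s t with h | h | h
    · exact Or.inl (inter_eq_left.2 h)
    · exact Or.inr (Or.inl (inter_eq_right.2 h))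
    · exact Or.inr (Or.inr h.inter_eq)
  refine ext_of_generate_finite C ?_ ?_ ?_ (by simpa using hxx)
  · have hb : TopologicalSpace.IsTopologicalBasis C := by
      refine TopologicalSpace.isTopologicalBasis_of_isOpen_of_nhds ?_ ?_
      · rintro _ ⟨y, s, rfl⟩; exact isOpen_ball
      · intro a u ha hu
        obtain ⟨e, he, hs⟩ := Metric.isOpen_iff.1 hu a ha
        exact ⟨_, ⟨a, e, rfl⟩, mem_ball_self he, hs⟩
    rw [BorelSpace.measurable_eq (α := X), hb.borel_eq_generateFrom]
  · rintro _ ⟨y, s, rfl⟩ _ ⟨z, t, rfl⟩ -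
    rcases hinter y s z t with h | h | h <;> rw [h]
    · exact ⟨_, _, rfl⟩
    · exact ⟨_, _, rfl⟩
    · exact ⟨y, 0, by simp⟩
  · rintro _ ⟨y, s, rfl⟩
    rw [Measure.restrict_apply isOpen_ball.measurableSet,
      Measure.restrict_apply isOpen_ball.measurableSet]
    rcases hinter y s x r with h' | h' | h'
    · rw [h']
      rcases le_or_gt s 0 with h0 | h0
      · simp [ball_eq_empty.2 h0]
      have hy : y ∈ ball x r := inter_eq_left.1 h' (mem_ball_self h0)
      rcases le_or_gt s r with h1 | h1
      · exact h y hy s h1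
      · have : ball y s = ball x r := by
          refine (inter_eq_left.1 h').antisymm ?_
          rw [IsUltrametricDist.ball_eq_of_mem hy]
          exact ball_subset_ball h1.le
        rw [this, hxx]
    · rw [h', hxx]
    · simp [h']

end

theorem stmt17 {p : ℕ} [Fact p.Prime] [MeasurableSpace ℚ_[p]] [BorelSpace ℚ_[p]]
    (μ : Measure ℚ_[p]) [μ.IsAddHaarMeasure] (hμ : μ {x : ℚ_[p] | ‖x‖ ≤ 1} = 1)
    (n : ℕ) (U V : Set (Fin n → ℚ_[p])) (hU : IsOpen U) (hV : IsOpen V)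
    (T : (Fin n → ℚ_[p]) → (Fin n → ℚ_[p])) (hT : Set.BijOn T U V)
    (T' : (Fin n → ℚ_[p]) → ((Fin n → ℚ_[p]) →L[ℚ_[p]] (Fin n → ℚ_[p])))
    (hT' : ∀ x ∈ U, HasStrictFDerivAt T (T' x) x)
    (g : (Fin n → ℚ_[p]) → (Fin n → ℚ_[p])) (hgT : ∀ x ∈ U, g (T x) = x)
    (g' : (Fin n → ℚ_[p]) → ((Fin n → ℚ_[p]) →L[ℚ_[p]] (Fin n → ℚ_[p])))
    (hg' : ∀ v ∈ V, HasStrictFDerivAt g (g' v) v)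
    (φ : (Fin n → ℚ_[p]) → ℝ)
    (hφ : IntegrableOn φ V (Measure.pi fun _ => μ)) :
    ∫ v in V, φ v ∂(Measure.pi fun _ => μ)
      = ∫ x in U, φ (T x) * ‖(T' x).det‖ ∂(Measure.pi fun _ => μ) := by
  set m : Measure (Fin n → ℚ_[p]) := Measure.pi fun _ => μ with hm
  -- invertibility of the derivative
  have hdet : ∀ x ∈ U, (T' x).det ≠ 0 := by
    intro x hx
    have h1 : HasFDerivAt (g ∘ T) ((g' (T x)).comp (T' x)) x :=
      ((hg' (T x) (hT.mapsTo hx)).comp x (hT' x hx)).hasFDerivAt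
    have h2 : HasFDerivAt (g ∘ T) (ContinuousLinearMap.id ℚ_[p] _) x := by
      refine (hasFDerivAt_id x).congr_of_eventuallyEq ?_
      filter_upwards [hU.mem_nhds hx] with y hy using hgT y hy
    have h3 := congrArg ContinuousLinearMap.det (h1.unique h2)
    have h4 : (g' (T x)).det * (T' x).det = 1 := by
      rw [ContinuousLinearMap.det, ContinuousLinearMap.det, ← LinearMap.det_comp]
      refine Eq.trans h3 ?_
      exact LinearMap.det_id
    exact right_ne_zero_of_mul_eq_one h4
  -- local scaling
  have hloc : ∀ x ∈ U, ∃ r > 0, ball x r ⊆ U ∧ ∀ y ∈ ball x r, ∀ s ≤ r,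
      m (T '' ball y s) = ENNReal.ofReal ‖(T' x).det‖ * m (ball y s) := by
    intro x hx
    have := padic_local μ hμ n T ((T' x).toContinuousLinearEquivOfDetNeZero (hdet x hx)) x
      (by simpa using hT' x hx) U (hU.mem_nhds hx)
    simpa using this
  have hpos : ∀ x s, 0 < s → m (ball x s) ≠ 0 := fun x s hs => (measure_ball_pos m x hs).ne'
  have hfin : ∀ x s, m (ball x s) ≠ ∞ := fun x s => measure_ball_lt_top.ne
  choose! r hr hrU hrm using hloc
  -- the Jacobian is locally constant
  have hconst : ∀ x ∈ U, ∀ y ∈ ball x (r x), ‖(T' y).det‖ = ‖(T' x).det‖ := by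
    intro x hx y hy
    have hyU := hrU x hx hy
    have hs : 0 < min (r x) (r y) := lt_min (hr x hx) (hr y hyU)
    have h1 := hrm x hx y hy (min (r x) (r y)) (min_le_left _ _)
    have h2 := hrm y hyU y (mem_ball_self (hr y hyU)) (min (r x) (r y)) (min_le_right _ _)
    rw [h1] at h2
    have h3 := (ENNReal.mul_left_inj (hpos _ _ hs) (hfin _ _)).1 h2
    exact ((ENNReal.ofReal_eq_ofReal_iff (norm_nonneg _) (norm_nonneg _)).1 h3).symm
  have hcont : ContinuousOn (fun x => ‖(T' x).det‖) U := by
    intro x hx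
    apply ContinuousAt.continuousWithinAt
    refine (continuousAt_const (y := ‖(T' x).det‖)).congr ?_
    filter_upwards [ball_mem_nhds x (hr x hx)] with y hy using (hconst x hx y hy).symm
  have hUm := hU.measurableSet
  have hTc : ContinuousOn T U := fun x hx => (hT' x hx).hasFDerivAt.continuousAt.continuousWithinAt
  have hemb : MeasurableEmbedding (U.domRestrict T) := hTc.measurableEmbedding hUm hT.injOn
  let ρ : Measure (Fin n → ℚ_[p]) := m.withDensity (fun x => ENNReal.ofReal ‖(T' x).det‖)
  let ν : Measure (Fin n → ℚ_[p]) := Measure.map Subtype.val (Measure.comap (U.domRestrict T) m)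
  have hν : ∀ E ⊆ U, MeasurableSet E → ν E = m (T '' E) := by
    intro E hE hEm
    rw [Measure.map_apply measurable_subtype_coe hEm, hemb.comap_apply]
    congr 1
    ext y
    constructor
    · rintro ⟨z, hz, rfl⟩; exact ⟨z, hz, rfl⟩
    · rintro ⟨z, hz, rfl⟩; exact ⟨⟨z, hE hz⟩, hz, rfl⟩
  have hρ : ∀ x ∈ U, ∀ y ∈ ball x (r x), ∀ s ≤ r x,
      ρ (ball y s) = ENNReal.ofReal ‖(T' x).det‖ * m (ball y s) := by
    intro x hx y hy s hs
    have hsub : ball y s ⊆ ball x (r x) := by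
      rw [IsUltrametricDist.ball_eq_of_mem hy]; exact ball_subset_ball hs
    rw [withDensity_apply _ isOpen_ball.measurableSet, setLIntegral_congr_fun
      (g := fun _ => ENNReal.ofReal ‖(T' x).det‖) isOpen_ball.measurableSet, setLIntegral_const]
    intro z hz
    simp only [hconst x hx z (hsub hz)]
  have hloceq : ∀ x ∈ U, ρ.restrict (ball x (r x)) = ν.restrict (ball x (r x)) := by
    intro x hx
    refine ultra_measure_ext ρ ν x (r x) (hr x hx) ?_ ?_
    · rw [hρ x hx x (mem_ball_self (hr x hx)) _ le_rfl]
      exact ENNReal.mul_ne_top ENNReal.ofReal_ne_top (hfin _ _)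
    · intro y hy s hs
      have hsub : ball y s ⊆ ball x (r x) := by
        rw [IsUltrametricDist.ball_eq_of_mem hy]; exact ball_subset_ball hs
      rw [hρ x hx y hy s hs, hν _ (hsub.trans (hrU x hx)) isOpen_ball.measurableSet,
        hrm x hx y hy s hs]
  have hglob : ρ.restrict U = ν.restrict U := by
    obtain ⟨t, htU, htc, hcov⟩ := TopologicalSpace.countable_cover_nhdsWithin
      (f := fun x => ball x (r x)) (s := U)
      (fun x hx => mem_nhdsWithin_of_mem_nhds (ball_mem_nhds x (hr x hx)))
    have : U = ⋃ x ∈ t, ball x (r x) :=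
      hcov.antisymm (iUnion₂_subset fun x hx => hrU x (htU hx))
    rw [this, Measure.restrict_biUnion_congr htc]
    exact fun x hx => hloceq x (htU hx)
  have hmap : Measure.map (U.domRestrict T) (Measure.comap Subtype.val ρ) = m.restrict V := by
    have h1 : Measure.comap Subtype.val ρ = Measure.comap (U.domRestrict T) m := by
      ext E hE
      have hEm := (MeasurableEmbedding.subtype_coe hUm).measurableSet_image.2 hE
      have hEU : Subtype.val '' E ⊆ U := by rintro _ ⟨z, -, rfl⟩; exact z.2
      rw [(MeasurableEmbedding.subtype_coe hUm).comap_apply, hemb.comap_apply]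
      have h2 := congrArg (fun q => q (Subtype.val '' E)) hglob
      simp only [Measure.restrict_apply hEm, inter_eq_left.2 hEU] at h2
      rw [h2, hν _ hEU hEm, ← image_comp]
      rfl
    rw [h1, hemb.map_comap, Set.range_domRestrict, hT.image_eq]
  rw [← hmap, hemb.integral_map]
  simp only [Set.domRestrict_apply]
  rw [← (MeasurableEmbedding.subtype_coe hUm).integral_map (g := fun x => φ (T x)),
    map_comap_subtype_coe hUm]
  have haem : AEMeasurable (fun x => ‖(T' x).det‖.toNNReal) (m.restrict U) :=
    (hcont.aemeasurable hUm).real_toNNReal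
  refine (setIntegral_withDensity_eq_setIntegral_smul₀ haem (fun x => φ (T x)) hUm).trans ?_
  congr with x
  rw [NNReal.smul_def, Real.coe_toNNReal _ (norm_nonneg _), smul_eq_mul, mul_comm]
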